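/- arXiv:1803.06847 — 2 statements merged into one kernel-verified Lean document; each statement's English description precedes it below -/
import Mathlib

section
/- Let n ≥ 2, p ≥ 2, and let X be a random vector uniformly distributed on the ℓ_p unit ball B_p^n. Set ξ1 = (e1+e2)/√2 and ξ2 = (e1−e2)/√2, and define f(η1,η2) = E[⟨X,η1⟩²⟨X,η2⟩²] − E[⟨X,η1⟩²]·E[⟨X,η2⟩²]. Then for every pair of orthonormal vectors η1, η2 in the unit sphere S^{n−1} one has f(ξ1,ξ2) ≤ f(η1,η2) ≤ f(e1,e2). -/
open MeasureTheory Real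
open scoped RealInnerProductSpace ENNReal

noncomputable section

/-- `ℝⁿ` with the Euclidean structure. -/
abbrev E (n : ℕ) := EuclideanSpace ℝ (Fin n)

/-- The unit ball of the `ℓ_p` norm on `ℝⁿ`. -/
def lpBall (n : ℕ) (p : ℝ) : Set (E n) := {x | ∑ i, |x i| ^ p ≤ 1}

/-- The uniform probability measure (normalized Lebesgue measure) on a set `K ⊆ ℝⁿ`. -/
def unif {n : ℕ} (K : Set (E n)) : Measure (E n) := (volume K)⁻¹ • volume.restrict K

/-- `f(η₁,η₂) = E⟨X,η₁⟩²⟨X,η₂⟩² - E⟨X,η₁⟩² E⟨X,η₂⟩²` for `X` distributed according to `μ`. -/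
def covf {n : ℕ} (μ : Measure (E n)) (a b : E n) : ℝ :=
  (∫ x, ⟪x, a⟫ ^ 2 * ⟪x, b⟫ ^ 2 ∂μ) - (∫ x, ⟪x, a⟫ ^ 2 ∂μ) * (∫ x, ⟪x, b⟫ ^ 2 ∂μ)

/-- The canonical basis vectors of `ℝⁿ`. -/
def stdb {n : ℕ} (i : Fin n) : E n := EuclideanSpace.single i 1


lemma aux_conv {q a b c d : ℝ} (hq : 1 ≤ q) (ha : 0 ≤ a) (hb : 0 ≤ b)
    (hs : a + b = c + d) (hd : (c - d) ^ 2 ≤ (a - b) ^ 2) : c ^ q + d ^ q ≤ a ^ q + b ^ q := by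
  by_cases h : a = b
  · subst h
    have : c - d = 0 := by nlinarith [sq_nonneg (c - d)]
    have h1 : c = a := by linarith
    have h2 : d = a := by linarith
    rw [h1, h2]
  · have hD : a - b ≠ 0 := sub_ne_zero.2 h
    have hE : ((c - d) / (a - b)) ^ 2 ≤ 1 := by
      rw [div_pow, div_le_one (by positivity)]; exact hd
    have hE' := abs_le.1 ((sq_le_one_iff_abs_le_one _).1 hE)
    set e := (c - d) / (a - b) with he
    have hed : e * (a - b) = c - d := by rw [he]; field_simp
    have hc : c = (1 + e) / 2 * a + (1 - e) / 2 * b := by linarith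
    have hdd : d = (1 - e) / 2 * a + (1 + e) / 2 * b := by linarith
    have cv := convexOn_rpow hq
    have h1 := cv.2 (Set.mem_Ici.2 ha) (Set.mem_Ici.2 hb) (show 0 ≤ (1 + e) / 2 by linarith)
      (show 0 ≤ (1 - e) / 2 by linarith) (by ring)
    have h2 := cv.2 (Set.mem_Ici.2 ha) (Set.mem_Ici.2 hb) (show 0 ≤ (1 - e) / 2 by linarith)
      (show 0 ≤ (1 + e) / 2 by linarith) (by ring)
    simp only [smul_eq_mul] at h1 h2
    rw [← hc] at h1
    rw [← hdd] at h2
    linarith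

lemma aux_conv' {p x y u v : ℝ} (hp : 2 ≤ p) (hs : x ^ 2 + y ^ 2 = u ^ 2 + v ^ 2)
    (hd : (u ^ 2 - v ^ 2) ^ 2 ≤ (x ^ 2 - y ^ 2) ^ 2) :
    |u| ^ p + |v| ^ p ≤ |x| ^ p + |y| ^ p := by
  have key : ∀ t : ℝ, |t| ^ p = (t ^ 2) ^ (p / 2) := by
    intro t
    rw [← sq_abs, ← Real.rpow_natCast, ← Real.rpow_mul (abs_nonneg t)]
    congr 1; push_cast; ring
  simp only [key]
  exact aux_conv (by linarith) (by positivity) (by positivity) hs hd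

lemma aux_S {n : ℕ} (a b : Fin n → ℝ) (ha : ∑ i, a i ^ 2 = 1) (hb : ∑ i, b i ^ 2 = 1)
    (hab : ∑ i, a i * b i = 0) : ∑ i, a i ^ 2 * b i ^ 2 ≤ 1 / 2 := by
  have h1 : ∑ i, |a i * b i| ≤ 1 := by
    calc ∑ i, |a i * b i| ≤ ∑ i, (a i ^ 2 + b i ^ 2) / 2 := by
          refine Finset.sum_le_sum fun i _ => ?_
          rw [abs_le]; constructor <;> nlinarith [sq_nonneg (a i + b i), sq_nonneg (a i - b i)]
      _ = 1 := by rw [← Finset.sum_div, Finset.sum_add_distrib, ha, hb]; norm_num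
  have h2 : ∀ i, |a i * b i| ≤ 1 / 2 := by
    intro i
    have e1 := Finset.add_sum_erase Finset.univ (fun i => |a i * b i|) (Finset.mem_univ i)
    have e2 := Finset.add_sum_erase Finset.univ (fun i => a i * b i) (Finset.mem_univ i)
    rw [hab] at e2
    have e3 := Finset.abs_sum_le_sum_abs (fun i => a i * b i) (Finset.univ.erase i)
    have e4 : ∑ x ∈ Finset.univ.erase i, a x * b x = - (a i * b i) := by linarith
    rw [e4, abs_neg] at e3
    linarith
  calc ∑ i, a i ^ 2 * b i ^ 2 = ∑ i, |a i * b i| * |a i * b i| := by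
        refine Finset.sum_congr rfl fun i _ => ?_
        rw [abs_mul_abs_self]; ring
    _ ≤ ∑ i, 1 / 2 * |a i * b i| :=
        Finset.sum_le_sum fun i _ => mul_le_mul_of_nonneg_right (h2 i) (abs_nonneg _)
    _ ≤ 1 / 2 := by rw [← Finset.mul_sum]; linarith

lemma lpBall_coord {n : ℕ} {p : ℝ} (hp : 2 ≤ p) {x : E n} (hx : x ∈ lpBall n p) (i : Fin n) :
    |x i| ≤ 1 := by
  have h : |x i| ^ p ≤ 1 := le_trans
    (Finset.single_le_sum (f := fun i => |x i| ^ p) (fun j _ => by positivity) (Finset.mem_univ i)) hx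
  by_contra hc
  push Not at hc
  exact absurd h (not_le.2 (Real.one_lt_rpow hc (by linarith)))

lemma lpBall_meas (n : ℕ) {p : ℝ} (hp : 2 ≤ p) : MeasurableSet (lpBall n p) := by
  apply IsClosed.measurableSet
  apply isClosed_le _ continuous_const
  refine continuous_finsetSum _ fun i _ => ?_
  refine Continuous.rpow_const (by fun_prop) fun x => Or.inr (by linarith)

lemma lpBall_fin (n : ℕ) {p : ℝ} (hp : 2 ≤ p) : volume (lpBall n p) < ⊤ := by
  apply Bornology.IsBounded.measure_lt_top
  rw [isBounded_iff_forall_norm_le]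
  refine ⟨√n, fun x hx => ?_⟩
  rw [EuclideanSpace.norm_eq]
  apply Real.sqrt_le_sqrt
  calc ∑ i, ‖x i‖ ^ 2 ≤ ∑ i : Fin n, (1 : ℝ) := by
        refine Finset.sum_le_sum fun i _ => ?_
        have := lpBall_coord hp hx i
        rw [Real.norm_eq_abs]
        exact pow_le_one₀ (abs_nonneg _) this
    _ = n := by simp

lemma lpBall_int {n : ℕ} {p : ℝ} (hp : 2 ≤ p) {f : E n → ℝ} (hf : Continuous f) (C : ℝ)
    (hC : ∀ x ∈ lpBall n p, |f x| ≤ C) : IntegrableOn f (lpBall n p) volume := by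
  refine Measure.integrableOn_of_bounded (M := C) (lpBall_fin n hp).ne hf.aestronglyMeasurable ?_
  rw [ae_restrict_iff' (lpBall_meas n hp)]
  exact Filter.Eventually.of_forall hC

lemma unif_integral {n : ℕ} (K : Set (E n)) (f : E n → ℝ) :
    ∫ x, f x ∂(unif K) = (volume K)⁻¹.toReal * ∫ x in K, f x := by
  rw [unif, integral_smul_measure, smul_eq_mul]

lemma unif_inv {n : ℕ} (K : Set (E n)) (T : E n ≃ₗᵢ[ℝ] E n) (hT : T ⁻¹' K = K) (f : E n → ℝ) :
    ∫ x in K, f (T x) = ∫ x in K, f x := by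
  have := T.measurePreserving.setIntegral_preimage_emb T.toHomeomorph.measurableEmbedding f K
  rw [hT] at this
  exact this

/-- unnormalized fourth moments -/
def M4 (n : ℕ) (p : ℝ) (i j k l : Fin n) : ℝ := ∫ x in lpBall n p, x i * x j * x k * x l
/-- unnormalized second moments -/
def M2 (n : ℕ) (p : ℝ) (i j : Fin n) : ℝ := ∫ x in lpBall n p, x i * x j

def cflip {n : ℕ} (i : Fin n) : E n ≃ₗᵢ[ℝ] E n :=
  LinearIsometryEquiv.piLpCongrRight 2
    (fun j => if j = i then LinearIsometryEquiv.neg ℝ else LinearIsometryEquiv.refl ℝ ℝ)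

lemma cflip_apply {n : ℕ} (i j : Fin n) (x : E n) :
    cflip i x j = (if j = i then -1 else 1) * x j := by
  simp only [cflip, LinearIsometryEquiv.piLpCongrRight_apply]
  split_ifs <;> simp

lemma cflip_pre {n : ℕ} (p : ℝ) (i : Fin n) : cflip i ⁻¹' lpBall n p = lpBall n p := by
  ext x
  simp only [lpBall, Set.mem_preimage, Set.mem_ofPred_eq, cflip_apply, abs_mul]
  have : ∀ j, |(if j = i then (-1 : ℝ) else 1)| = 1 := by intro j; split_ifs <;> simp
  simp [this]

def cperm {n : ℕ} (s : Equiv.Perm (Fin n)) : E n ≃ₗᵢ[ℝ] E n :=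
  LinearIsometryEquiv.piLpCongrLeft 2 ℝ ℝ s.symm

lemma cperm_apply {n : ℕ} (s : Equiv.Perm (Fin n)) (x : E n) (j) : cperm s x j = x (s j) := by
  simp [cperm, LinearIsometryEquiv.piLpCongrLeft_apply, Equiv.piCongrLeft']

lemma cperm_pre {n : ℕ} (p : ℝ) (s : Equiv.Perm (Fin n)) : cperm s ⁻¹' lpBall n p = lpBall n p := by
  ext x
  simp only [lpBall, Set.mem_preimage, Set.mem_ofPred_eq, cperm_apply]
  rw [Equiv.sum_comp s (fun j => |x j| ^ p)]

lemma M4_flip {n : ℕ} (p : ℝ) (t i j k l : Fin n) : M4 n p i j k l =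
    ((if i = t then -1 else 1) * (if j = t then -1 else 1) * (if k = t then -1 else 1) *
      (if l = t then -1 else 1)) * M4 n p i j k l := by
  conv_lhs => rw [M4, ← unif_inv _ (cflip t) (cflip_pre p t)]
  rw [M4, ← integral_const_mul]
  congr 1; ext x
  simp only [cflip_apply]; ring

lemma M2_flip {n : ℕ} (p : ℝ) (t i j : Fin n) : M2 n p i j =
    ((if i = t then -1 else 1) * (if j = t then -1 else 1)) * M2 n p i j := by
  conv_lhs => rw [M2, ← unif_inv _ (cflip t) (cflip_pre p t)]
  rw [M2, ← integral_const_mul]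
  congr 1; ext x
  simp only [cflip_apply]; ring

lemma M4_perm {n : ℕ} (p : ℝ) (s : Equiv.Perm (Fin n)) (i j k l : Fin n) :
    M4 n p (s i) (s j) (s k) (s l) = M4 n p i j k l := by
  conv_rhs => rw [M4, ← unif_inv _ (cperm s) (cperm_pre p s)]
  simp only [M4, cperm_apply]

lemma M2_perm {n : ℕ} (p : ℝ) (s : Equiv.Perm (Fin n)) (i j : Fin n) :
    M2 n p (s i) (s j) = M2 n p i j := by
  conv_rhs => rw [M2, ← unif_inv _ (cperm s) (cperm_pre p s)]
  simp only [M2, cperm_apply]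

lemma M2_eq {n : ℕ} (p : ℝ) (o i j : Fin n) :
    M2 n p i j = M2 n p o o * (if i = j then 1 else 0) := by
  by_cases h : i = j
  · subst h
    have := M2_perm p (Equiv.swap o i) o o
    simp only [Equiv.swap_apply_left] at this
    simp [this]
  · have := M2_flip p i i j
    simp only [if_true, Ne.symm h, if_false] at this
    simp only [h, if_false]; linarith

lemma M4_diag {n : ℕ} (p : ℝ) (o i : Fin n) : M4 n p i i i i = M4 n p o o o o := by
  have := M4_perm p (Equiv.swap o i) o o o o
  simpa only [Equiv.swap_apply_left] using this

lemma M4_pair {n : ℕ} (p : ℝ) {o e i j : Fin n} (hoe : o ≠ e) (hij : i ≠ j) :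
    M4 n p i i j j = M4 n p o o e e := by
  set j' := (Equiv.swap o i).symm j with hj'
  have hj : j' ≠ o := by
    intro h
    apply hij
    have h5 : Equiv.swap o i j' = j := by rw [hj', Equiv.apply_symm_apply]
    rw [h, Equiv.swap_apply_left] at h5
    exact h5
  have := M4_perm p (Equiv.swap o i) o o j' j'
  rw [hj'] at this
  simp only [Equiv.swap_apply_left, Equiv.apply_symm_apply] at this
  rw [this, ← hj', ← M4_perm p (Equiv.swap e j') o o e e]
  simp only [Equiv.swap_apply_left, Equiv.swap_apply_of_ne_of_ne hoe hj.symm]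

lemma M4_comm1 {n : ℕ} (p : ℝ) (i j k l : Fin n) : M4 n p i j k l = M4 n p i k j l := by
  simp only [M4]; congr 1; ext x; ring
lemma M4_comm2 {n : ℕ} (p : ℝ) (i j k l : Fin n) : M4 n p i j k l = M4 n p i j l k := by
  simp only [M4]; congr 1; ext x; ring

lemma M4_eq {n : ℕ} (p : ℝ) {o e : Fin n} (hoe : o ≠ e) (i j k l : Fin n) :
    M4 n p i j k l = M4 n p o o e e * ((if i = j then 1 else 0) * (if k = l then 1 else 0)
      + (if i = k then 1 else 0) * (if j = l then 1 else 0)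
      + (if i = l then 1 else 0) * (if j = k then 1 else 0))
      + (M4 n p o o o o - 3 * M4 n p o o e e) *
        ((if i = j then 1 else 0) * (if i = k then 1 else 0) * (if i = l then 1 else 0)) := by
  have fi := M4_flip p i i j k l
  have fj := M4_flip p j i j k l
  have fk := M4_flip p k i j k l
  have fl := M4_flip p l i j k l
  by_cases h1 : i = j
  · subst h1
    by_cases h2 : k = l
    · subst h2
      by_cases h3 : i = k
      · subst h3
        rw [M4_diag p o i]; simp; ring
      · rw [M4_pair p hoe h3]; simp [h3]
    · by_cases h3 : i = k
      · subst h3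
        simp only [h2, Ne.symm h2, if_true, if_false] at *; linarith
      · simp only [h2, h3, Ne.symm h2, Ne.symm h3, if_true, if_false] at *; linarith
  · by_cases h2 : i = k
    · subst h2
      by_cases h3 : j = l
      · subst h3
        rw [M4_comm1, M4_pair p hoe h1]; simp [h1, Ne.symm h1]
      · simp only [h1, Ne.symm h1, h3, Ne.symm h3, if_true, if_false] at *; linarith
    · by_cases h3 : i = l
      · subst h3
        by_cases h4 : j = k
        · subst h4
          rw [M4_comm2, M4_comm1, M4_pair p hoe h1]; simp [h1]
        · simp only [h1, Ne.symm h1, h4, Ne.symm h4, h2, Ne.symm h2, if_true, if_false] at *; linarith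
      · simp only [h1, Ne.symm h1, h2, Ne.symm h2, h3, Ne.symm h3, if_true, if_false] at *; linarith

lemma int4 {n : ℕ} {p : ℝ} (hp : 2 ≤ p) (i j k l : Fin n) :
    IntegrableOn (fun x : E n => x i * x j * x k * x l) (lpBall n p) := by
  refine lpBall_int hp (by fun_prop) 1 fun x hx => ?_
  simp only [abs_mul]
  have := lpBall_coord hp hx
  exact mul_le_one₀ (mul_le_one₀ (mul_le_one₀ (this i) (abs_nonneg _) (this j)) (abs_nonneg _)
    (this k)) (abs_nonneg _) (this l)

lemma int2 {n : ℕ} {p : ℝ} (hp : 2 ≤ p) (i j : Fin n) :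
    IntegrableOn (fun x : E n => x i * x j) (lpBall n p) := by
  refine lpBall_int hp (by fun_prop) 1 fun x hx => ?_
  simp only [abs_mul]
  have := lpBall_coord hp hx
  exact mul_le_one₀ (this i) (abs_nonneg _) (this j)

lemma E4 {n : ℕ} {p : ℝ} (hp : 2 ≤ p) {o e : Fin n} (hoe : o ≠ e) (a b : E n) :
    ∫ x in lpBall n p, ⟪x, a⟫ ^ 2 * ⟪x, b⟫ ^ 2 =
      M4 n p o o e e * ((∑ i, a i ^ 2) * (∑ i, b i ^ 2) + 2 * (∑ i, a i * b i) ^ 2) +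
      (M4 n p o o o o - 3 * M4 n p o o e e) * ∑ i, a i ^ 2 * b i ^ 2 := by
  have h1 : ∀ x : E n, ⟪x, a⟫ ^ 2 * ⟪x, b⟫ ^ 2 =
      ∑ i, ∑ j, ∑ k, ∑ l, (a i * a j * b k * b l) * (x i * x j * x k * x l) := by
    intro x
    simp only [PiLp.inner_apply, RCLike.inner_apply, conj_trivial]
    rw [sq, sq, mul_assoc, Finset.sum_mul]
    refine Finset.sum_congr rfl fun i _ => ?_
    rw [Finset.sum_mul, Finset.mul_sum]
    refine Finset.sum_congr rfl fun j _ => ?_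
    rw [Finset.sum_mul, Finset.mul_sum, Finset.mul_sum]
    refine Finset.sum_congr rfl fun k _ => ?_
    rw [Finset.mul_sum, Finset.mul_sum, Finset.mul_sum]
    refine Finset.sum_congr rfl fun l _ => ?_
    ring
  have hi := fun i j k l => (int4 hp i j k l : IntegrableOn (fun x : E n => _) _ _).const_mul (a i * a j * b k * b l)
  simp only [h1]
  rw [integral_finsetSum _ fun i _ => integrable_finsetSum _ fun j _ => integrable_finsetSum _
    fun k _ => integrable_finsetSum _ fun l _ => hi i j k l]
  have h2 : ∀ i, ∫ x in lpBall n p, ∑ j, ∑ k, ∑ l, (a i * a j * b k * b l) * (x i * x j * x k * x l)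
      = ∑ j, ∑ k, ∑ l, (a i * a j * b k * b l) * M4 n p i j k l := by
    intro i
    rw [integral_finsetSum _ fun j _ => integrable_finsetSum _
      fun k _ => integrable_finsetSum _ fun l _ => hi i j k l]
    refine Finset.sum_congr rfl fun j _ => ?_
    rw [integral_finsetSum _ fun k _ => integrable_finsetSum _ fun l _ => hi i j k l]
    refine Finset.sum_congr rfl fun k _ => ?_
    rw [integral_finsetSum _ fun l _ => hi i j k l]
    refine Finset.sum_congr rfl fun l _ => ?_
    rw [integral_const_mul, M4]
  simp only [h2]
  have hM := M4_eq p hoe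
  generalize M4 n p o o e e = B at hM ⊢
  generalize M4 n p o o o o - 3 * B = C at hM ⊢
  simp only [hM]
  have h3 : ∀ i j k l, (a i * a j * b k * b l) * (B * ((if i = j then 1 else 0) * (if k = l then 1 else 0)
      + (if i = k then 1 else 0) * (if j = l then 1 else 0)
      + (if i = l then 1 else 0) * (if j = k then 1 else 0))
      + C * ((if i = j then 1 else 0) * (if i = k then 1 else 0) * (if i = l then 1 else 0)))
    = (if i = j then if k = l then B * (a i ^ 2 * b k ^ 2) else 0 else 0)
      + (if i = k then if j = l then B * (a i * b i * (a j * b j)) else 0 else 0)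
      + (if i = l then if j = k then B * (a i * b i * (a j * b j)) else 0 else 0)
      + (if i = j then if i = k then if i = l then C * (a i ^ 2 * b i ^ 2) else 0 else 0 else 0) := by
    intro i j k l
    have z1 : ∀ u v : ℝ, (if i = j then if k = l then u else 0 else 0) = (if i = j then 1 else 0) * (if k = l then 1 else 0) * u := by
      intros; split_ifs <;> simp
    by_cases c1 : i = j
    · subst c1
      by_cases c2 : k = l
      · subst c2
        by_cases c3 : i = k
        · subst c3; simp; ring
        · simp [c3]; ring
      · by_cases c3 : i = k
        · subst c3; simp [c2]
        · simp [c2, c3]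
    · by_cases c2 : i = k
      · subst c2
        by_cases c3 : j = l
        · subst c3; simp [c1, Ne.symm c1]; ring
        · simp [c1, Ne.symm c1, c3]
      · by_cases c3 : i = l
        · subst c3
          by_cases c4 : j = k
          · subst c4; simp [c1]; ring
          · simp [c1, c2, c4]
        · simp [c1, c2, c3]
  simp only [h3, Finset.sum_add_distrib]
  have s1 : ∑ i, ∑ j, ∑ k, ∑ l, (if i = j then if k = l then B * (a i ^ 2 * b k ^ 2) else 0 else 0)
      = B * ((∑ i, a i ^ 2) * (∑ i, b i ^ 2)) := by
    rw [Finset.sum_mul_sum, Finset.mul_sum]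
    refine Finset.sum_congr rfl fun i _ => ?_
    rw [Finset.sum_eq_single i (by intro j _ h; simp [Ne.symm h]) (by simp), Finset.mul_sum]
    refine Finset.sum_congr rfl fun j _ => ?_
    simp
  have s2 : ∑ i, ∑ j, ∑ k, ∑ l, (if i = k then if j = l then B * (a i * b i * (a j * b j)) else 0 else 0)
      = B * (∑ i, a i * b i) ^ 2 := by
    rw [sq, Finset.sum_mul_sum, Finset.mul_sum]
    refine Finset.sum_congr rfl fun i _ => ?_
    rw [Finset.mul_sum]
    refine Finset.sum_congr rfl fun j _ => ?_
    rw [Finset.sum_eq_single i (by intro j _ h; simp [Ne.symm h]) (by simp)]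
    simp
  have s3 : ∑ i, ∑ j, ∑ k, ∑ l, (if i = l then if j = k then B * (a i * b i * (a j * b j)) else 0 else 0)
      = B * (∑ i, a i * b i) ^ 2 := by
    rw [sq, Finset.sum_mul_sum, Finset.mul_sum]
    refine Finset.sum_congr rfl fun i _ => ?_
    rw [Finset.mul_sum]
    refine Finset.sum_congr rfl fun j _ => ?_
    rw [Finset.sum_eq_single j (by intro j _ h; simp [Ne.symm h]) (by simp)]
    simp
  have s4 : ∑ i, ∑ j, ∑ k, ∑ l, (if i = j then if i = k then if i = l then C * (a i ^ 2 * b i ^ 2) else 0 else 0 else 0)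
      = C * ∑ i, a i ^ 2 * b i ^ 2 := by
    rw [Finset.mul_sum]
    refine Finset.sum_congr rfl fun i _ => ?_
    rw [Finset.sum_eq_single i (by intro j _ h; simp [Ne.symm h]) (by simp)]
    rw [Finset.sum_eq_single i (by intro j _ h; simp [Ne.symm h]) (by simp)]
    simp
  rw [s1, s2, s3, s4]; ring

lemma E2 {n : ℕ} {p : ℝ} (hp : 2 ≤ p) (o : Fin n) (a : E n) :
    ∫ x in lpBall n p, ⟪x, a⟫ ^ 2 = M2 n p o o * ∑ i, a i ^ 2 := by
  have h1 : ∀ x : E n, ⟪x, a⟫ ^ 2 = ∑ i, ∑ j, (a i * a j) * (x i * x j) := by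
    intro x
    simp only [PiLp.inner_apply, RCLike.inner_apply, conj_trivial]
    rw [sq, Finset.sum_mul]
    refine Finset.sum_congr rfl fun i _ => ?_
    rw [Finset.mul_sum]
    refine Finset.sum_congr rfl fun j _ => ?_
    ring
  have hi := fun i j => (int2 hp i j : IntegrableOn (fun x : E n => _) _ _).const_mul (a i * a j)
  simp only [h1]
  rw [integral_finsetSum _ fun i _ => integrable_finsetSum _ fun j _ => hi i j, Finset.mul_sum]
  refine Finset.sum_congr rfl fun i _ => ?_
  rw [integral_finsetSum _ fun j _ => hi i j]
  have : ∀ j, ∫ x in lpBall n p, (a i * a j) * (x i * x j)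
      = if i = j then M2 n p o o * a i ^ 2 else 0 := by
    intro j
    rw [integral_const_mul]
    change _ * M2 n p i j = _
    rw [M2_eq p o i j]
    split_ifs with h
    · subst h; ring
    · ring
  simp [this]

/-- the orthogonal map `(x_o, x_e) ↦ ((x_o + x_e)/√2, (x_o - x_e)/√2)` -/
def rotL {n : ℕ} (o e : Fin n) : E n →ₗ[ℝ] E n where
  toFun x := WithLp.toLp 2 fun k => if k = o then (√2)⁻¹ * (x o + x e) else
    if k = e then (√2)⁻¹ * (x o - x e) else x k
  map_add' x y := by
    ext k; simp only [PiLp.add_apply]; split_ifs <;> ring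
  map_smul' c x := by
    ext k; simp only [PiLp.smul_apply, smul_eq_mul, RingHom.id_apply]; split_ifs <;> ring

lemma rotL_apply {n : ℕ} (o e : Fin n) (x : E n) (k) : rotL o e x k =
    if k = o then (√2)⁻¹ * (x o + x e) else if k = e then (√2)⁻¹ * (x o - x e) else x k := rfl

lemma sum_split {n : ℕ} {o e : Fin n} (hoe : o ≠ e) (f : Fin n → ℝ) :
    ∑ i, f i = f o + f e + ∑ i ∈ (Finset.univ.erase o).erase e, f i := by
  rw [← Finset.add_sum_erase _ f (Finset.mem_univ o),
    ← Finset.add_sum_erase _ f (Finset.mem_erase.2 ⟨hoe.symm, Finset.mem_univ e⟩), add_assoc]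

lemma rotL_norm {n : ℕ} {o e : Fin n} (hoe : o ≠ e) (x : E n) : ‖rotL o e x‖ = ‖x‖ := by
  rw [EuclideanSpace.norm_eq, EuclideanSpace.norm_eq]
  congr 1
  rw [sum_split hoe, sum_split hoe (fun i => ‖x i‖ ^ 2)]
  congr 1
  · simp only [rotL_apply, hoe.symm, if_true, if_false, Real.norm_eq_abs, sq_abs, mul_pow, inv_pow]
    rw [Real.sq_sqrt (by norm_num)]; ring
  · refine Finset.sum_congr rfl fun i hi => ?_
    simp only [Finset.mem_erase] at hi
    simp [rotL_apply, hi.1, hi.2.1]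

def rot {n : ℕ} {o e : Fin n} (hoe : o ≠ e) : E n ≃ₗᵢ[ℝ] E n :=
  (LinearIsometry.mk (rotL o e) (rotL_norm hoe)).toLinearIsometryEquiv rfl

lemma rot_apply {n : ℕ} {o e : Fin n} (hoe : o ≠ e) (x : E n) (k) : rot hoe x k =
    if k = o then (√2)⁻¹ * (x o + x e) else if k = e then (√2)⁻¹ * (x o - x e) else x k := rfl

/-- `r⁴ cos 4φ` in the plane of the coordinates `o`, `e`. -/
def gg {n : ℕ} (o e : Fin n) (x : E n) : ℝ := (x o ^ 2 - x e ^ 2) ^ 2 - 4 * x o ^ 2 * x e ^ 2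

lemma gg_int {n : ℕ} {p : ℝ} (hp : 2 ≤ p) {o e : Fin n} (hoe : o ≠ e) :
    ∫ x in lpBall n p, gg o e x = 2 * (M4 n p o o o o - 3 * M4 n p o o e e) := by
  have : ∀ x : E n, gg o e x = x o * x o * x o * x o + x e * x e * x e * x e
      - 6 * (x o * x o * x e * x e) := by intro x; simp only [gg]; ring
  simp only [this]
  rw [integral_sub, integral_add, integral_const_mul]
  · change M4 n p o o o o + M4 n p e e e e - 6 * M4 n p o o e e = _
    rw [M4_diag p o e]; ring
  · exact int4 hp _ _ _ _
  · exact int4 hp _ _ _ _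
  · exact (int4 hp _ _ _ _).add (int4 hp _ _ _ _)
  · exact (int4 hp _ _ _ _ : IntegrableOn (fun x : E n => _) _ _).const_mul 6

lemma rot_gg {n : ℕ} {o e : Fin n} (hoe : o ≠ e) (x : E n) : gg o e (rot hoe x) = - gg o e x := by
  have h2 : ((√2)⁻¹ : ℝ) ^ 2 = 1 / 2 := by rw [inv_pow, Real.sq_sqrt (by norm_num)]; norm_num
  simp only [gg, rot_apply, hoe.symm, if_true, if_false, mul_pow, h2]
  ring

lemma rot_sum {n : ℕ} {o e : Fin n} (hoe : o ≠ e) (p : ℝ) (x : E n) :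
    ∑ i, |rot hoe x i| ^ p - ∑ i, |x i| ^ p =
      |rot hoe x o| ^ p + |rot hoe x e| ^ p - (|x o| ^ p + |x e| ^ p) := by
  rw [sum_split hoe, sum_split hoe (fun i => |x i| ^ p)]
  have : ∑ i ∈ (Finset.univ.erase o).erase e, |rot hoe x i| ^ p
      = ∑ i ∈ (Finset.univ.erase o).erase e, |x i| ^ p := by
    refine Finset.sum_congr rfl fun i hi => ?_
    simp only [Finset.mem_erase] at hi
    simp [rot_apply, hi.1, hi.2.1]
  rw [this]; ring

lemma rot_point {n : ℕ} {p : ℝ} (hp : 2 ≤ p) {o e : Fin n} (hoe : o ≠ e) (x : E n) :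
    (lpBall n p).indicator (gg o e) x + (lpBall n p).indicator (gg o e) (rot hoe x) ≤ 0 := by
  have h2 : ((√2)⁻¹ : ℝ) ^ 2 = 1 / 2 := by rw [inv_pow, Real.sq_sqrt (by norm_num)]; norm_num
  have hs := rot_sum hoe p x
  have eo : rot hoe x o ^ 2 = (x o + x e) ^ 2 / 2 := by
    simp only [rot_apply, if_true, mul_pow, h2]; ring
  have ee : rot hoe x e ^ 2 = (x o - x e) ^ 2 / 2 := by
    simp only [rot_apply, hoe.symm, if_true, if_false, mul_pow, h2]; ring
  have e1 : x o ^ 2 + x e ^ 2 = rot hoe x o ^ 2 + rot hoe x e ^ 2 := by rw [eo, ee]; ring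
  have e2 : gg o e x = (x o ^ 2 - x e ^ 2) ^ 2 - (rot hoe x o ^ 2 - rot hoe x e ^ 2) ^ 2 := by
    rw [eo, ee, gg]; ring
  classical
  rw [Set.indicator_apply, Set.indicator_apply, rot_gg]
  rcases le_total 0 (gg o e x) with hg | hg
  · have := aux_conv' hp e1 (by linarith)
    have hm : x ∈ lpBall n p → rot hoe x ∈ lpBall n p := by
      simp only [lpBall, Set.mem_ofPred_eq]; intro h; linarith
    split_ifs with c1 c2 <;> first | linarith | exact absurd (hm c1) c2
  · have := aux_conv' hp e1.symm (by linarith)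
    have hm : rot hoe x ∈ lpBall n p → x ∈ lpBall n p := by
      simp only [lpBall, Set.mem_ofPred_eq]; intro h; linarith
    split_ifs with c1 c2 c2 <;> first | linarith | exact absurd (hm c2) c1

lemma key {n : ℕ} {p : ℝ} (hp : 2 ≤ p) {o e : Fin n} (hoe : o ≠ e) :
    M4 n p o o o o - 3 * M4 n p o o e e ≤ 0 := by
  have hI : IntegrableOn (gg o e) (lpBall n p) volume := by
    refine lpBall_int hp (by unfold gg; fun_prop) 5 fun x hx => ?_
    have ho := (sq_le_one_iff_abs_le_one _).2 (lpBall_coord hp hx o)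
    have he := (sq_le_one_iff_abs_le_one _).2 (lpBall_coord hp hx e)
    have h1 := sq_nonneg (x o)
    have h2 := sq_nonneg (x e)
    rw [abs_le, gg]
    constructor <;> nlinarith [mul_le_one₀ ho h2 he, mul_nonneg h1 h2]
  have hI' := hI.integrable_indicator (lpBall_meas n hp)
  have h1 := (rot hoe).measurePreserving.integral_comp (rot hoe).toHomeomorph.measurableEmbedding
    ((lpBall n p).indicator (gg o e))
  have hI2 : Integrable (fun x => (lpBall n p).indicator (gg o e) (rot hoe x)) volume := (rot hoe).measurePreserving.integrable_comp_of_integrable hI'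
  have h2 : ∫ x, ((lpBall n p).indicator (gg o e) x + (lpBall n p).indicator (gg o e) (rot hoe x))
      ≤ 0 := integral_nonpos fun x => rot_point hp hoe x
  rw [integral_add hI' hI2, h1, integral_indicator (lpBall_meas n hp), gg_int hp hoe] at h2
  linarith

lemma covf_eq {n : ℕ} {p : ℝ} (hp : 2 ≤ p) {o e : Fin n} (hoe : o ≠ e) (a b : E n)
    (ha : ∑ i, a i ^ 2 = 1) (hb : ∑ i, b i ^ 2 = 1) (hab : ∑ i, a i * b i = 0) :
    covf (unif (lpBall n p)) a b = (volume (lpBall n p))⁻¹.toReal * M4 n p o o e e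
      - ((volume (lpBall n p))⁻¹.toReal * M2 n p o o) ^ 2
      + (volume (lpBall n p))⁻¹.toReal * (M4 n p o o o o - 3 * M4 n p o o e e) *
        ∑ i, a i ^ 2 * b i ^ 2 := by
  rw [covf, unif_integral, unif_integral, unif_integral, E4 hp hoe, E2 hp o, E2 hp o, ha, hb, hab]
  ring

/-- For `p ≥ 2`, the extremal pairs of `f` on `B_p^n` are
`(ξ₁,ξ₂) = ((e₁+e₂)/√2, (e₁-e₂)/√2)` (minimum) and `(e₁,e₂)` (maximum). -/
theorem sncp_Bpn_extremal_pairs_p_ge_two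
    (n : ℕ) (hn : 2 ≤ n) (p : ℝ) (hp : 2 ≤ p)
    (η₁ η₂ : E n) (hη₁ : ‖η₁‖ = 1) (hη₂ : ‖η₂‖ = 1) (hortho : ⟪η₁, η₂⟫ = 0) :
    covf (unif (lpBall n p))
        ((Real.sqrt 2)⁻¹ • (stdb (⟨0, by omega⟩ : Fin n) + stdb ⟨1, by omega⟩))
        ((Real.sqrt 2)⁻¹ • (stdb (⟨0, by omega⟩ : Fin n) - stdb ⟨1, by omega⟩)) ≤
      covf (unif (lpBall n p)) η₁ η₂ ∧
    covf (unif (lpBall n p)) η₁ η₂ ≤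
      covf (unif (lpBall n p)) (stdb (⟨0, by omega⟩ : Fin n)) (stdb ⟨1, by omega⟩) := by

  have hoe : (⟨0, by omega⟩ : Fin n) ≠ ⟨1, by omega⟩ := by simp
  generalize (⟨0, by omega⟩ : Fin n) = o at hoe ⊢
  generalize (⟨1, by omega⟩ : Fin n) = e at hoe ⊢
  have n1 : ∑ i, η₁ i ^ 2 = 1 := by rw [← EuclideanSpace.real_norm_sq_eq, hη₁]; norm_num
  have n2 : ∑ i, η₂ i ^ 2 = 1 := by rw [← EuclideanSpace.real_norm_sq_eq, hη₂]; norm_num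
  have n3 : ∑ i, η₁ i * η₂ i = 0 := by
    rw [← hortho]
    simp only [PiLp.inner_apply, RCLike.inner_apply, conj_trivial]
    exact Finset.sum_congr rfl fun i _ => mul_comm _ _
  have h2 : ((√2)⁻¹ : ℝ) ^ 2 = 1 / 2 := by rw [inv_pow, Real.sq_sqrt (by norm_num)]; norm_num
  have z : ∀ i ∈ (Finset.univ.erase o).erase e, i ≠ e ∧ i ≠ o := by
    intro i hi
    simp only [Finset.mem_erase] at hi
    exact ⟨hi.1, hi.2.1⟩
  have hc : 0 ≤ (volume (lpBall n p))⁻¹.toReal := ENNReal.toReal_nonneg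
  have hk := mul_nonpos_of_nonneg_of_nonpos hc (key hp hoe)
  have hS := aux_S _ _ n1 n2 n3
  have hS0 : 0 ≤ ∑ i, η₁ i ^ 2 * η₂ i ^ 2 := Finset.sum_nonneg fun i _ => by positivity
  have st : ∀ i k : Fin n, (stdb i : E n) k = if k = i then 1 else 0 := by
    intro i k; simp [stdb, EuclideanSpace.single_apply]
  have hoe' := hoe.symm
  rw [covf_eq hp hoe η₁ η₂ n1 n2 n3]
  constructor
  · rw [covf_eq hp hoe]
    · rw [sum_split hoe, Finset.sum_eq_zero]
      · simp only [PiLp.smul_apply, PiLp.add_apply, PiLp.sub_apply, smul_eq_mul, st, hoe, hoe',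
          if_true, if_false, mul_pow, h2]
        nlinarith
      · intro i hi
        simp [st, z i hi]
    · rw [sum_split hoe, Finset.sum_eq_zero]
      · simp only [PiLp.smul_apply, PiLp.add_apply, PiLp.sub_apply, smul_eq_mul, st, hoe, hoe',
          if_true, if_false, mul_pow, h2]
        norm_num
      · intro i hi
        simp [st, z i hi]
    · rw [sum_split hoe, Finset.sum_eq_zero]
      · simp only [PiLp.smul_apply, PiLp.add_apply, PiLp.sub_apply, smul_eq_mul, st, hoe, hoe',
          if_true, if_false, mul_pow, h2]
        norm_num
      · intro i hi
        simp [st, z i hi]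
    · rw [sum_split hoe, Finset.sum_eq_zero]
      · simp only [PiLp.smul_apply, PiLp.add_apply, PiLp.sub_apply, smul_eq_mul, st, hoe, hoe',
          if_true, if_false]
        ring
      · intro i hi
        simp [st, z i hi]
  · rw [covf_eq hp hoe (stdb o) (stdb e) (by simp [st]) (by simp [st]) (by simp [st, hoe'])]
    have : ∑ i, (stdb o : E n) i ^ 2 * (stdb e : E n) i ^ 2 = 0 := by simp [st, hoe']
    rw [this]
    nlinarith
end
end

section
/- Let n ≥ 2, p ≥ 2, and let X be a random vector uniformly distributed on the ℓ_p unit ball B_p^n. Then X satisfies the square negative correlation property with respect to every orthonormal basis of ℝ^n; that is, for every orthonormal basis {η_i}_{i=1}^n and every i ≠ j, E[⟨X,η_i⟩²⟨X,η_j⟩²] ≤ E[⟨X,η_i⟩²]·E[⟨X,η_j⟩²]. -/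
open MeasureTheory Real
open scoped RealInnerProductSpace ENNReal

noncomputable section

lemma gamma_four {a b c d : ℝ} (ha : 0 < a) (hab : a ≤ b) (hac : a ≤ c) (h : b + c = a + d) :
    Gamma b * Gamma c ≤ Gamma a * Gamma d := by
  rcases eq_or_lt_of_le (show a ≤ d by linarith) with had | had
  · have hb : b = a := by linarith
    have hc : c = a := by linarith
    rw [hb, hc, ← had]
  · have hda : 0 < d - a := by linarith
    have key := convexOn_log_Gamma.2
    have hA := Gamma_pos_of_pos ha
    have hB := Gamma_pos_of_pos (show 0 < b by linarith)
    have hC := Gamma_pos_of_pos (show 0 < c by linarith)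
    have hD := Gamma_pos_of_pos (show 0 < d by linarith)
    have hc : c = a + d - b := by linarith
    have k1 := key (show a ∈ Set.Ioi (0:ℝ) from ha) (show d ∈ Set.Ioi (0:ℝ) from ha.trans had)
      (show 0 ≤ (d - b) / (d - a) from div_nonneg (by linarith) hda.le)
      (show 0 ≤ (b - a) / (d - a) from div_nonneg (by linarith) hda.le) (by field_simp; ring)
    have k2 := key (show a ∈ Set.Ioi (0:ℝ) from ha) (show d ∈ Set.Ioi (0:ℝ) from ha.trans had)
      (show 0 ≤ (b - a) / (d - a) from div_nonneg (by linarith) hda.le)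
      (show 0 ≤ (d - b) / (d - a) from div_nonneg (by linarith) hda.le) (by field_simp; ring)
    simp only [smul_eq_mul, Function.comp_apply] at k1 k2
    rw [show (d - b) / (d - a) * a + (b - a) / (d - a) * d = b by field_simp; ring] at k1
    rw [show (b - a) / (d - a) * a + (d - b) / (d - a) * d = c by rw [hc]; field_simp; ring] at k2
    rw [← log_le_log_iff (by positivity) (by positivity), log_mul hB.ne' hC.ne',
      log_mul hA.ne' hD.ne']
    have e : (d - b) / (d - a) = 1 - (b - a) / (d - a) := by field_simp; ring
    rw [e] at k1 k2
    linarith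

lemma even_mom {p : ℝ} (hp : 0 < p) (k : ℕ) :
    ∫ t : ℝ, t ^ (2 * k) * exp (-|t| ^ p) = 2 * ((1 / p) * Gamma (((2 * k : ℕ) + 1) / p)) := by
  rw [← integral_rpow_mul_exp_neg_rpow hp (by have : (0:ℝ) ≤ (2 * k : ℕ) := by positivity
                                              linarith), ← integral_comp_abs]
  congr 1; ext t
  rw [rpow_natCast, pow_mul, pow_mul, sq_abs]

lemma odd_mom {p : ℝ} (k : ℕ) (hk : Odd k) :
    ∫ t : ℝ, t ^ k * exp (-|t| ^ p) = 0 := by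
  have := integral_neg_eq_self (fun t : ℝ => t ^ k * exp (-|t| ^ p)) volume
  simp only [hk.neg_pow, abs_neg, neg_mul, integral_neg] at this
  linarith

lemma mom_integrable {p : ℝ} (hp : 0 < p) (k : ℕ) :
    Integrable (fun t : ℝ => t ^ k * exp (-|t| ^ p)) := by
  have h0 : Integrable (fun t : ℝ => (fun s : ℝ => s ^ (k : ℝ) * exp (- s ^ p)) |t|) := by
    apply Integrable.of_integral_ne_zero
    have hk : (0:ℝ) ≤ k := by positivity
    rw [integral_comp_abs (f := fun s : ℝ => s ^ (k : ℝ) * exp (- s ^ p)),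
      integral_rpow_mul_exp_neg_rpow hp (by linarith)]
    have := Gamma_pos_of_pos (show 0 < ((k:ℝ) + 1) / p by positivity)
    positivity
  refine h0.mono' ?_ ?_
  · apply Measurable.aestronglyMeasurable
    fun_prop
  · refine Filter.Eventually.of_forall fun t => ?_
    simp

lemma kurt {p : ℝ} (hp : 2 ≤ p) :
    Gamma (5 / p) * Gamma (1 / p) ≤ 3 * Gamma (3 / p) ^ 2 := by
  have hp0 : 0 < p := by linarith
  have h := gamma_four (a := 3 / p) (b := 5 / p) (c := 1 / p + 1) (d := 3 / p + 1)
    (by positivity) (by gcongr; norm_num)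
    (by field_simp; linarith) (by field_simp; ring)
  rw [Gamma_add_one (by positivity), Gamma_add_one (by positivity)] at h
  have : (1 / p) * (Gamma (5 / p) * Gamma (1 / p)) ≤ (1 / p) * (3 * Gamma (3 / p) ^ 2) := by
    calc _ = Gamma (5 / p) * (1 / p * Gamma (1 / p)) := by ring
      _ ≤ _ := h
      _ = _ := by ring
  exact le_of_mul_le_mul_left this (by positivity)


lemma wick4 {n : ℕ} (H : ℕ → ℝ) (h0 : H 0 = 1) (h1 : H 1 = 0) (h3 : H 3 = 0) (k l m r : Fin n) :
    ∏ i, H ((if i = k then 1 else 0) + (if i = l then 1 else 0) + (if i = m then 1 else 0)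
      + (if i = r then 1 else 0)) =
    H 2 ^ 2 * ((if k = l then 1 else 0) * (if m = r then 1 else 0)
      + (if k = m then 1 else 0) * (if l = r then 1 else 0)
      + (if k = r then 1 else 0) * (if l = m then 1 else 0))
    + (H 4 - 3 * H 2 ^ 2) * ((if k = l then 1 else 0) * (if k = m then 1 else 0)
      * (if k = r then 1 else 0)) := by
  rw [← Finset.prod_subset (Finset.subset_univ ({k, l, m, r} : Finset (Fin n)))]
  · by_cases hkl : k = l <;> by_cases hkm : k = m <;> by_cases hkr : k = r <;>
    by_cases hlm : l = m <;> by_cases hlr : l = r <;> by_cases hmr : m = r <;>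
    first
    | (exfalso; grind)
    | (have e1 := Ne.symm hkl) | skip
    all_goals
      first
      | (subst_vars; simp_all [Finset.prod_insert, eq_comm]; done)
      | (subst_vars; simp_all [Finset.prod_insert, eq_comm]; ring)
  · intro i _ hi
    simp only [Finset.mem_insert, Finset.mem_singleton, not_or] at hi
    simp [hi, h0]

lemma wick2 {n : ℕ} (H : ℕ → ℝ) (h0 : H 0 = 1) (h1 : H 1 = 0) (k l : Fin n) :
    ∏ i, H ((if i = k then 1 else 0) + (if i = l then 1 else 0)) =
    H 2 * (if k = l then 1 else 0) := by
  rw [← Finset.prod_subset (Finset.subset_univ ({k, l} : Finset (Fin n)))]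
  · by_cases hkl : k = l
    · subst hkl; simp
    · simp [Finset.prod_pair hkl, hkl, h1]
  · intro i _ hi
    simp only [Finset.mem_insert, Finset.mem_singleton, not_or] at hi
    simp [hi, h0]


lemma scale_l {n : ℕ} {p : ℝ} (hp : 0 < p) (d : ℕ) (F : (Fin n → ℝ) → ℝ≥0∞) (hF : Measurable F)
    (hh : ∀ r : ℝ, 0 < r → ∀ x, F (r • x) = ENNReal.ofReal (r ^ d) * F x) (t : ℝ) (ht : 0 < t) :
    ∫⁻ x in {x : Fin n → ℝ | ∑ i, |x i| ^ p ≤ t}, F x =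
      ENNReal.ofReal (t ^ (((n : ℝ) + d) / p)) * ∫⁻ x in {x : Fin n → ℝ | ∑ i, |x i| ^ p ≤ 1}, F x := by
  have hm : ∀ t : ℝ, MeasurableSet {x : Fin n → ℝ | ∑ i, |x i| ^ p ≤ t} := fun t =>
    measurableSet_le (by fun_prop) (by fun_prop)
  set r : ℝ := t ^ (1 / p) with hr
  have hr0 : 0 < r := rpow_pos_of_pos ht _
  have hrp : r ^ p = t := by rw [hr, ← rpow_mul ht.le]; field_simp; simp
  have hmap := Measure.map_addHaar_smul (volume : Measure (Fin n → ℝ)) hr0.ne'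
  have h1 := lintegral_map (μ := (volume : Measure (Fin n → ℝ)))
    (hF.indicator (hm t)) (measurable_const_smul r)
  rw [hmap, lintegral_smul_measure, lintegral_indicator (hm t)] at h1
  have h2 : ∀ x : Fin n → ℝ, {x : Fin n → ℝ | ∑ i, |x i| ^ p ≤ t}.indicator F (r • x) =
      ENNReal.ofReal (r ^ d) * {x : Fin n → ℝ | ∑ i, |x i| ^ p ≤ 1}.indicator F x := by
    intro x
    have : r • x ∈ {x : Fin n → ℝ | ∑ i, |x i| ^ p ≤ t} ↔ x ∈ {x : Fin n → ℝ | ∑ i, |x i| ^ p ≤ 1} := by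
      simp only [Set.mem_ofPred_eq, Pi.smul_apply, smul_eq_mul, abs_mul, abs_of_pos hr0]
      simp_rw [mul_rpow hr0.le (abs_nonneg _), hrp, ← Finset.mul_sum]
      constructor
      · intro h
        by_contra hc
        push Not at hc
        nlinarith
      · intro h; nlinarith
    by_cases hx : x ∈ {x : Fin n → ℝ | ∑ i, |x i| ^ p ≤ 1}
    · rw [Set.indicator_of_mem hx, Set.indicator_of_mem (this.2 hx), hh r hr0]
    · rw [Set.indicator_of_notMem hx, Set.indicator_of_notMem (fun h => hx (this.1 h)), mul_zero]
  simp_rw [h2] at h1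
  rw [lintegral_const_mul _ (hF.indicator (hm 1)), lintegral_indicator (hm 1)] at h1
  have h3 : t ^ (((n : ℝ) + d) / p) = r ^ n * r ^ d := by
    rw [← pow_add, hr, ← rpow_natCast, ← rpow_mul ht.le]; congr 1; push_cast; field_simp
  rw [h3, ENNReal.ofReal_mul (by positivity), mul_assoc, ← h1, smul_eq_mul, ← mul_assoc,
    ← ENNReal.ofReal_mul (by positivity)]
  simp only [Module.finrank_fintype_fun_eq_card, Fintype.card_fin]
  rw [abs_of_pos (by positivity), mul_inv_cancel₀ (by positivity)]
  simp

lemma layer {n : ℕ} {p : ℝ} (hp : 0 < p) (d : ℕ) (F : (Fin n → ℝ) → ℝ≥0∞) (hF : Measurable F)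
    (hh : ∀ r : ℝ, 0 < r → ∀ x, F (r • x) = ENNReal.ofReal (r ^ d) * F x) :
    ∫⁻ x, F x * ENNReal.ofReal (exp (-∑ i, |x i| ^ p)) =
      ENNReal.ofReal (Gamma (1 + ((n : ℝ) + d) / p)) *
        ∫⁻ x in {x : Fin n → ℝ | ∑ i, |x i| ^ p ≤ 1}, F x := by
  have hm : ∀ t : ℝ, MeasurableSet {x : Fin n → ℝ | ∑ i, |x i| ^ p ≤ t} := fun t =>
    measurableSet_le (by fun_prop) (by fun_prop)
  have hexp : ∀ c : ℝ, ENNReal.ofReal (exp (-c)) =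
      ∫⁻ t, (Set.Ici c).indicator (fun t => ENNReal.ofReal (exp (-t))) t := by
    intro c
    rw [lintegral_indicator measurableSet_Ici, setLIntegral_congr Ioi_ae_eq_Ici.symm,
      ← ofReal_integral_eq_lintegral_ofReal (integrableOn_exp_neg_Ioi c)
        (Filter.Eventually.of_forall fun t => (exp_pos _).le), integral_exp_neg_Ioi]
  have hswap : ∫⁻ x, F x * ENNReal.ofReal (exp (-∑ i, |x i| ^ p)) =
      ∫⁻ t : ℝ, ∫⁻ x : Fin n → ℝ, F x *
        (Set.Ici (∑ i, |x i| ^ p)).indicator (fun t => ENNReal.ofReal (exp (-t))) t := by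
    rw [← lintegral_lintegral_swap]
    · refine lintegral_congr fun x => ?_
      rw [hexp, lintegral_const_mul]
      exact Measurable.indicator (by fun_prop) measurableSet_Ici
    · apply Measurable.aemeasurable
      have : (Function.uncurry fun (x : Fin n → ℝ) (t : ℝ) => F x *
          (Set.Ici (∑ i, |x i| ^ p)).indicator (fun t => ENNReal.ofReal (exp (-t))) t) =
          fun z : (Fin n → ℝ) × ℝ => F z.1 * ({z : (Fin n → ℝ) × ℝ | ∑ i, |z.1 i| ^ p ≤ z.2}.indicator
            (fun z => ENNReal.ofReal (exp (-z.2))) z) := by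
        ext ⟨x, t⟩
        simp [Function.uncurry, Set.indicator]
      rw [this]
      refine (hF.comp measurable_fst).mul (Measurable.indicator (by fun_prop) ?_)
      exact measurableSet_le (by fun_prop) (by fun_prop)
  rw [hswap]
  set C := ∫⁻ x in {x : Fin n → ℝ | ∑ i, |x i| ^ p ≤ 1}, F x with hC
  have hin : ∀ᵐ t : ℝ, ∫⁻ x : Fin n → ℝ, F x *
        (Set.Ici (∑ i, |x i| ^ p)).indicator (fun t => ENNReal.ofReal (exp (-t))) t =
      (Set.Ioi (0:ℝ)).indicator
        (fun t => ENNReal.ofReal (exp (-t) * t ^ ((1 + ((n : ℝ) + d) / p) - 1))) t * C := by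
    have h0 : ∀ᵐ t : ℝ, t ≠ 0 := by simp [ae_iff]
    filter_upwards [h0] with t ht
    have e1 : ∀ x : Fin n → ℝ, F x *
        (Set.Ici (∑ i, |x i| ^ p)).indicator (fun t => ENNReal.ofReal (exp (-t))) t =
        ENNReal.ofReal (exp (-t)) * {x : Fin n → ℝ | ∑ i, |x i| ^ p ≤ t}.indicator F x := by
      intro x
      by_cases hx : ∑ i, |x i| ^ p ≤ t
      · simp [Set.indicator, hx, mul_comm]
      · simp [Set.indicator, hx]
    simp_rw [e1]
    rw [lintegral_const_mul _ (hF.indicator (hm t)), lintegral_indicator (hm t)]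
    rcases lt_or_gt_of_ne ht with h | h
    · have : {x : Fin n → ℝ | ∑ i, |x i| ^ p ≤ t} = ∅ := by
        ext x
        have : 0 ≤ ∑ i, |x i| ^ p := Finset.sum_nonneg fun i _ => by positivity
        simp; linarith
      rw [this]
      simp [h.le]
    · rw [scale_l hp d F hF hh t h, Set.indicator_of_mem (show t ∈ Set.Ioi 0 from h),
        ENNReal.ofReal_mul (exp_pos _).le, ← mul_assoc]
      simp [hC]
  have hpos : 0 < 1 + ((n : ℝ) + d) / p := by positivity
  rw [lintegral_congr_ae hin, lintegral_mul_const, lintegral_indicator measurableSet_Ioi,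
    ← ofReal_integral_eq_lintegral_ofReal (GammaIntegral_convergent hpos), Gamma_eq_integral hpos]
  · filter_upwards [ae_restrict_mem measurableSet_Ioi] with t ht
    have : (0:ℝ) < t := ht
    simp only [Pi.zero_apply]
    positivity
  · exact Measurable.indicator (by fun_prop) measurableSet_Ioi

lemma layer_real {n : ℕ} {p : ℝ} (hp : 0 < p) (d : ℕ) (f : (Fin n → ℝ) → ℝ) (hf : Measurable f)
    (h0 : ∀ x, 0 ≤ f x) (hh : ∀ r : ℝ, 0 < r → ∀ x, f (r • x) = r ^ d * f x) :
    ∫ x, f x * exp (-∑ i, |x i| ^ p) =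
      Gamma (1 + ((n : ℝ) + d) / p) * ∫ x in {x : Fin n → ℝ | ∑ i, |x i| ^ p ≤ 1}, f x := by
  have := layer hp d (fun x => ENNReal.ofReal (f x)) (by fun_prop)
    (fun r hr x => by rw [hh r hr, ENNReal.ofReal_mul (by positivity)])
  rw [integral_eq_lintegral_of_nonneg_ae, integral_eq_lintegral_of_nonneg_ae]
  · simp_rw [ENNReal.ofReal_mul (h0 _)]
    rw [this, ENNReal.toReal_mul, ENNReal.toReal_ofReal]
    exact (Gamma_pos_of_pos (by positivity)).le
  · exact Filter.Eventually.of_forall h0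
  · exact hf.aestronglyMeasurable
  · exact Filter.Eventually.of_forall fun x => mul_nonneg (h0 x) (exp_pos _).le
  · apply Measurable.aestronglyMeasurable; fun_prop

lemma mom_prod {n : ℕ} {p z : ℝ} (hp : 0 < p) (hz : z ≠ 0) (e : Fin n → ℕ) :
    Integrable (fun x : Fin n → ℝ => (∏ i, x i ^ e i) * exp (-∑ i, |x i| ^ p)) ∧
    ∫ x : Fin n → ℝ, (∏ i, x i ^ e i) * exp (-∑ i, |x i| ^ p) =
      z ^ n * ∏ i, ((∫ t : ℝ, t ^ e i * exp (-|t| ^ p)) / z) := by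
  have h : (fun x : Fin n → ℝ => (∏ i, x i ^ e i) * exp (-∑ i, |x i| ^ p)) =
      fun x => ∏ i, (fun i t => t ^ e i * exp (-|t| ^ p)) i (x i) := by
    ext x
    rw [← Finset.sum_neg_distrib, exp_sum, ← Finset.prod_mul_distrib]
  rw [h]
  refine ⟨Integrable.fintype_prod fun i => mom_integrable hp (e i), ?_⟩
  rw [integral_fintype_prod_volume_eq_prod (fun i t => t ^ e i * exp (-|t| ^ p)), Finset.prod_div_distrib, Finset.prod_const]
  simp only [Finset.card_univ, Fintype.card_fin]
  field_simp

lemma prod_pow2 {n : ℕ} (x : Fin n → ℝ) (k l : Fin n) :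
    ∏ i, x i ^ ((if i = k then 1 else 0) + (if i = l then 1 else 0)) = x k * x l := by
  simp_rw [pow_add, Finset.prod_mul_distrib]
  simp

lemma prod_pow4 {n : ℕ} (x : Fin n → ℝ) (k l m r : Fin n) :
    ∏ i, x i ^ ((if i = k then 1 else 0) + (if i = l then 1 else 0) + (if i = m then 1 else 0)
      + (if i = r then 1 else 0)) = x k * x l * x m * x r := by
  simp_rw [pow_add, Finset.prod_mul_distrib]
  simp

/-- Normalized one-dimensional moments. -/
def gm (p : ℝ) (k : ℕ) : ℝ :=
  (∫ t : ℝ, t ^ k * exp (-|t| ^ p)) / (∫ t : ℝ, t ^ 0 * exp (-|t| ^ p))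

lemma z_pos {p : ℝ} (hp : 0 < p) : 0 < ∫ t : ℝ, t ^ 0 * exp (-|t| ^ p) := by
  have h := even_mom hp 0
  simp only [mul_zero] at h
  rw [h]
  have := Gamma_pos_of_pos (show 0 < (((0:ℕ):ℝ) + 1) / p by simp [hp])
  positivity

lemma gm_zero {p : ℝ} (hp : 0 < p) : gm p 0 = 1 := div_self (z_pos hp).ne'

lemma gm_odd {p : ℝ} (k : ℕ) (hk : Odd k) : gm p k = 0 := by
  rw [gm, odd_mom k hk, zero_div]

lemma gm_kurt {p : ℝ} (hp : 2 ≤ p) : gm p 4 ≤ 3 * gm p 2 ^ 2 := by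
  have hp0 : 0 < p := by linarith
  have h0 := even_mom hp0 0
  have h2 := even_mom hp0 1
  have h4 := even_mom hp0 2
  norm_num at h0 h2 h4
  have k := kurt hp
  have hg := Gamma_pos_of_pos (show 0 < 1 / p by positivity)
  simp only [gm, pow_zero, one_mul, h0, h2, h4]
  rw [one_div] at k hg
  rw [div_pow, ← mul_div_assoc, div_le_div_iff₀ (by positivity) (by positivity)]
  have : 0 ≤ 8 * p⁻¹ ^ 3 * Gamma p⁻¹ := by positivity
  calc _ = 8 * p⁻¹ ^ 3 * Gamma p⁻¹ * (Gamma (5 / p) * Gamma p⁻¹) := by ring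
    _ ≤ 8 * p⁻¹ ^ 3 * Gamma p⁻¹ * (3 * Gamma (3 / p) ^ 2) := mul_le_mul_of_nonneg_left k this
    _ = _ := by ring

lemma J2 {n : ℕ} {p : ℝ} (hp : 0 < p) (a : Fin n → ℝ) :
    ∫ x : Fin n → ℝ, (∑ k, x k * a k) ^ 2 * exp (-∑ i, |x i| ^ p) =
      (∫ t : ℝ, t ^ 0 * exp (-|t| ^ p)) ^ n * (gm p 2 * ∑ k, a k ^ 2) := by
  have hz := (z_pos hp).ne'
  have M := fun k l : Fin n => mom_prod hp hz
    (fun i => (if i = k then 1 else 0) + (if i = l then 1 else 0))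
  simp only [prod_pow2] at M
  have e : ∀ x : Fin n → ℝ, (∑ k, x k * a k) ^ 2 * exp (-∑ i, |x i| ^ p) =
      ∑ k, ∑ l, (a k * a l) * (x k * x l * exp (-∑ i, |x i| ^ p)) := by
    intro x
    rw [sq, Finset.sum_mul_sum, Finset.sum_mul]
    refine Finset.sum_congr rfl fun k _ => ?_
    rw [Finset.sum_mul]
    refine Finset.sum_congr rfl fun l _ => ?_
    ring
  simp_rw [e]
  rw [integral_finsetSum _ fun k _ => integrable_finsetSum _ fun l _ => (M k l).1.const_mul _]
  have e2 : ∀ k, ∫ x : Fin n → ℝ, ∑ l, (a k * a l) * (x k * x l * exp (-∑ i, |x i| ^ p)) =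
      ∑ l, (a k * a l) * ((∫ t : ℝ, t ^ 0 * exp (-|t| ^ p)) ^ n *
        (gm p 2 * (if k = l then 1 else 0))) := by
    intro k
    rw [integral_finsetSum _ fun l _ => (M k l).1.const_mul _]
    refine Finset.sum_congr rfl fun l _ => ?_
    rw [integral_const_mul, (M k l).2]
    congr 2
    exact wick2 (gm p) (gm_zero hp) (gm_odd 1 (by decide)) k l
  simp_rw [e2]
  simp only [mul_ite, mul_one, mul_zero, Finset.sum_ite_eq, Finset.mem_univ, if_true]
  rw [Finset.mul_sum, Finset.mul_sum]
  refine Finset.sum_congr rfl fun k _ => ?_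
  ring

lemma sum4_mul {n : ℕ} (u v : Fin n → ℝ) (w : ℝ) :
    (∑ k, u k) ^ 2 * (∑ m, v m) ^ 2 * w = ∑ k, ∑ l, ∑ m, ∑ r, u k * u l * v m * v r * w := by
  simp_rw [← Finset.sum_mul, ← Finset.mul_sum, ← Finset.sum_mul, ← Finset.mul_sum,
    ← Finset.sum_mul]
  rw [sq (∑ k, u k), Finset.sum_mul_sum]
  ring

lemma wick_sum {n : ℕ} (a c : Fin n → ℝ) (Z A K : ℝ) :
    ∑ k, ∑ l, ∑ m, ∑ r, a k * a l * c m * c r *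
      (Z * (A * ((if k = l then 1 else 0) * (if m = r then 1 else 0)
      + (if k = m then 1 else 0) * (if l = r then 1 else 0)
      + (if k = r then 1 else 0) * (if l = m then 1 else 0))
    + K * ((if k = l then 1 else 0) * (if k = m then 1 else 0)
      * (if k = r then 1 else 0)))) =
    Z * (A * ((∑ k, a k ^ 2) * (∑ k, c k ^ 2) + 2 * (∑ k, a k * c k) ^ 2)
         + K * ∑ k, a k ^ 2 * c k ^ 2) := by
  have s1 : ∀ k l : Fin n, ∑ m, ∑ r, a k * a l * c m * c r *
      (Z * (A * ((if k = l then 1 else 0) * (if m = r then 1 else 0)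
      + (if k = m then 1 else 0) * (if l = r then 1 else 0)
      + (if k = r then 1 else 0) * (if l = m then 1 else 0))
    + K * ((if k = l then 1 else 0) * (if k = m then 1 else 0)
      * (if k = r then 1 else 0)))) =
      Z * A * (∑ m, c m ^ 2) * (a k * a l * (if k = l then 1 else 0)) +
      2 * Z * A * ((a k * c k) * (a l * c l)) +
      Z * K * (a k * a l * c k * c k * (if k = l then 1 else 0)) := by
    intro k l
    have t : ∀ m r : Fin n, a k * a l * c m * c r *
      (Z * (A * ((if k = l then 1 else 0) * (if m = r then 1 else 0)
      + (if k = m then 1 else 0) * (if l = r then 1 else 0)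
      + (if k = r then 1 else 0) * (if l = m then 1 else 0))
    + K * ((if k = l then 1 else 0) * (if k = m then 1 else 0)
      * (if k = r then 1 else 0)))) =
      Z * A * (a k * a l * (if k = l then 1 else 0)) * (c m * c r * (if m = r then 1 else 0)) +
      Z * A * a k * a l * (c m * (if k = m then 1 else 0)) * (c r * (if l = r then 1 else 0)) +
      Z * A * a k * a l * (c m * (if l = m then 1 else 0)) * (c r * (if k = r then 1 else 0)) +
      Z * K * (a k * a l * (if k = l then 1 else 0)) * (c m * (if k = m then 1 else 0)) *
        (c r * (if k = r then 1 else 0)) := by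
      intro m r; ring
    simp_rw [t, Finset.sum_add_distrib, ← Finset.mul_sum, ← Finset.sum_mul, ← Finset.mul_sum]
    simp only [mul_ite, mul_one, mul_zero, Finset.sum_ite_eq, Finset.mem_univ, if_true, ← sq]
    split_ifs <;> ring
  simp_rw [s1, Finset.sum_add_distrib, ← Finset.mul_sum, ← Finset.sum_mul]
  simp only [mul_ite, mul_one, mul_zero, Finset.sum_ite_eq, Finset.mem_univ, if_true]
  have e1 : ∑ k, a k * a k = ∑ k, a k ^ 2 := Finset.sum_congr rfl fun k _ => by ring
  have e2 : ∑ k, a k * a k * c k * c k = ∑ k, a k ^ 2 * c k ^ 2 :=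
    Finset.sum_congr rfl fun k _ => by ring
  rw [e1, e2]
  ring

lemma J4 {n : ℕ} {p : ℝ} (hp : 0 < p) (a c : Fin n → ℝ) :
    ∫ x : Fin n → ℝ, (∑ k, x k * a k) ^ 2 * (∑ k, x k * c k) ^ 2 * exp (-∑ i, |x i| ^ p) =
      (∫ t : ℝ, t ^ 0 * exp (-|t| ^ p)) ^ n *
        (gm p 2 ^ 2 * ((∑ k, a k ^ 2) * (∑ k, c k ^ 2) + 2 * (∑ k, a k * c k) ^ 2)
         + (gm p 4 - 3 * gm p 2 ^ 2) * ∑ k, a k ^ 2 * c k ^ 2) := by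
  have hz := (z_pos hp).ne'
  have M := fun k l m r : Fin n => mom_prod hp hz
    (fun i => (if i = k then 1 else 0) + (if i = l then 1 else 0) + (if i = m then 1 else 0)
      + (if i = r then 1 else 0))
  simp only [prod_pow4] at M
  set Z := (∫ t : ℝ, t ^ 0 * exp (-|t| ^ p)) ^ n with hZ
  have e : ∀ x : Fin n → ℝ,
      (∑ k, x k * a k) ^ 2 * (∑ k, x k * c k) ^ 2 * exp (-∑ i, |x i| ^ p) =
      ∑ k, ∑ l, ∑ m, ∑ r, (a k * a l * c m * c r) *
        (x k * x l * x m * x r * exp (-∑ i, |x i| ^ p)) := by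
    intro x
    rw [sum4_mul]
    refine Finset.sum_congr rfl fun k _ => Finset.sum_congr rfl fun l _ =>
      Finset.sum_congr rfl fun m _ => Finset.sum_congr rfl fun r _ => ?_
    ring
  simp_rw [e]
  have I0 := fun k l m r => (M k l m r).1.const_mul (a k * a l * c m * c r)
  have I1 := fun k l m => integrable_finsetSum Finset.univ fun r _ => I0 k l m r
  have I2 := fun k l => integrable_finsetSum Finset.univ fun m _ => I1 k l m
  have I3 := fun k => integrable_finsetSum Finset.univ fun l _ => I2 k l
  rw [integral_finsetSum _ fun k _ => I3 k]
  simp_rw [integral_finsetSum Finset.univ fun l _ => I2 _ l,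
    integral_finsetSum Finset.univ fun m _ => I1 _ _ m,
    integral_finsetSum Finset.univ fun r _ => I0 _ _ _ r, integral_const_mul, (M _ _ _ _).2]
  have w := wick4 (n := n) (gm p) (gm_zero hp) (gm_odd 1 (by decide)) (gm_odd 3 (by decide))
  unfold gm at w ⊢
  simp_rw [w]
  exact wick_sum _ _ _ _ _

/-- Transfer of integrals over the uniform measure to integrals over a subset of `Fin n → ℝ`. -/
lemma unif_int {n : ℕ} (p : ℝ) (f : (Fin n → ℝ) → ℝ) :
    ∫ x, f x.ofLp ∂(unif (lpBall n p)) =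
      (∫ _x in {x : Fin n → ℝ | ∑ i, |x i| ^ p ≤ 1}, (1 : ℝ))⁻¹ *
        ∫ x in {x : Fin n → ℝ | ∑ i, |x i| ^ p ≤ 1}, f x := by
  have hm : MeasurableSet {x : Fin n → ℝ | ∑ i, |x i| ^ p ≤ 1} :=
    measurableSet_le (by fun_prop) (by fun_prop)
  have hpre : lpBall n p = WithLp.ofLp ⁻¹' {x : Fin n → ℝ | ∑ i, |x i| ^ p ≤ 1} := rfl
  have mp := PiLp.volume_preserving_ofLp (Fin n)
  have hv : volume (lpBall n p) = volume {x : Fin n → ℝ | ∑ i, |x i| ^ p ≤ 1} := by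
    rw [hpre, mp.measure_preimage hm.nullMeasurableSet]
  have hemb : MeasurableEmbedding (WithLp.ofLp : E n → (Fin n → ℝ)) :=
    (MeasurableEquiv.toLp 2 (Fin n → ℝ)).symm.measurableEmbedding
  rw [unif, integral_smul_measure, hv, hpre, mp.setIntegral_preimage_emb hemb]
  simp [Measure.real, ENNReal.toReal_inv]

/-- For `p ≥ 2`, a random vector uniformly distributed on `B_p^n` satisfies the
square negative correlation property with respect to every orthonormal basis of `ℝⁿ`. -/
theorem sncp_Bpn_p_ge_two_every_basis
    (n : ℕ) (hn : 2 ≤ n) (p : ℝ) (hp : 2 ≤ p)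
    (b : OrthonormalBasis (Fin n) ℝ (E n)) (i j : Fin n) (hij : i ≠ j) :
    (∫ x, ⟪x, b i⟫ ^ 2 * ⟪x, b j⟫ ^ 2 ∂(unif (lpBall n p))) ≤
      (∫ x, ⟪x, b i⟫ ^ 2 ∂(unif (lpBall n p))) * (∫ x, ⟪x, b j⟫ ^ 2 ∂(unif (lpBall n p))) := by
  have hp0 : 0 < p := by linarith
  set B := {x : Fin n → ℝ | ∑ i, |x i| ^ p ≤ 1} with hB
  have hin : ∀ (x : E n) (k : Fin n), ⟪x, b k⟫ = ∑ l, x.ofLp l * (b k).ofLp l := by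
    intro x k
    simp [PiLp.inner_apply, mul_comm]
  have hbb : ∀ k l : Fin n, ∑ m, (b k).ofLp m * (b l).ofLp m = if k = l then 1 else 0 := by
    intro k l
    rw [← hin (b k) l]
    exact orthonormal_iff_ite.1 b.orthonormal k l
  have hnorm : ∀ k : Fin n, ∑ m, (b k).ofLp m ^ 2 = 1 := by
    intro k
    have := hbb k k
    simpa [sq] using this
  have hort : ∑ m, (b i).ofLp m * (b j).ofLp m = 0 := by simpa [hij] using hbb i j
  simp_rw [hin]
  rw [unif_int p (fun x => (∑ l, x l * (b i).ofLp l) ^ 2 * (∑ l, x l * (b j).ofLp l) ^ 2),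
    unif_int p (fun x => (∑ l, x l * (b i).ofLp l) ^ 2),
    unif_int p (fun x => (∑ l, x l * (b j).ofLp l) ^ 2), ← hB]
  have hlin : ∀ (a : Fin n → ℝ) (r : ℝ) (x : Fin n → ℝ),
      ∑ l, (r • x) l * a l = r * ∑ l, x l * a l := by
    intro a r x
    rw [Finset.mul_sum]
    exact Finset.sum_congr rfl fun l _ => by simp [mul_assoc]
  have L0 := layer_real (n := n) hp0 0 (fun _ => 1) (by fun_prop) (fun _ => zero_le_one)
    (fun r _ x => by simp)
  have L2 := fun a : Fin n → ℝ => layer_real (n := n) hp0 2 (fun x => (∑ l, x l * a l) ^ 2)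
    (by fun_prop) (fun x => by positivity) (fun r _ x => by rw [hlin]; ring)
  have L4 := layer_real (n := n) hp0 4
    (fun x => (∑ l, x l * (b i).ofLp l) ^ 2 * (∑ l, x l * (b j).ofLp l) ^ 2)
    (by fun_prop) (fun x => by positivity) (fun r _ x => by rw [hlin, hlin]; ring)
  have L2i := L2 (b i).ofLp
  have L2j := L2 (b j).ofLp
  rw [J2 hp0, hnorm] at L2i L2j
  rw [J4 hp0, hnorm, hnorm, hort] at L4
  have M0 := (mom_prod (n := n) hp0 (z_pos hp0).ne' (fun _ => 0)).2
  have g0 := gm_zero hp0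
  unfold gm at g0
  simp only [g0, Finset.prod_const_one, mul_one] at M0
  simp only [pow_zero, Finset.prod_const_one] at M0 L0
  rw [M0] at L0
  simp only [pow_zero] at L2i L2j L4
  rw [← hB] at L0 L2i L2j L4
  have hz := z_pos hp0
  simp only [pow_zero] at hz
  have hZ := pow_pos hz n
  set Z := (∫ t : ℝ, 1 * exp (-|t| ^ p)) ^ n with hZdef
  have hK := gm_kurt hp
  set V := ∫ _x in B, (1 : ℝ)
  set I2i := ∫ x in B, (∑ l, x l * (b i).ofLp l) ^ 2
  set I2j := ∫ x in B, (∑ l, x l * (b j).ofLp l) ^ 2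
  set I4 := ∫ x in B, (∑ l, x l * (b i).ofLp l) ^ 2 * (∑ l, x l * (b j).ofLp l) ^ 2
  have hS : 0 ≤ ∑ k, (b i).ofLp k ^ 2 * (b j).ofLp k ^ 2 :=
    Finset.sum_nonneg fun k _ => by positivity
  set S := ∑ k, (b i).ofLp k ^ 2 * (b j).ofLp k ^ 2
  have G0 := Gamma_pos_of_pos (show 0 < 1 + ((n:ℝ) + (0:ℕ)) / p by positivity)
  have G2 := Gamma_pos_of_pos (show 0 < 1 + ((n:ℝ) + (2:ℕ)) / p by positivity)
  have G4 := Gamma_pos_of_pos (show 0 < 1 + ((n:ℝ) + (4:ℕ)) / p by positivity)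
  have hG := gamma_four (a := 1 + ((n:ℝ) + (0:ℕ)) / p) (b := 1 + ((n:ℝ) + (2:ℕ)) / p)
    (c := 1 + ((n:ℝ) + (2:ℕ)) / p) (d := 1 + ((n:ℝ) + (4:ℕ)) / p) (by positivity)
    (by gcongr; norm_num) (by gcongr; norm_num) (by push_cast; field_simp; ring)
  set Γ0 := Gamma (1 + ((n:ℝ) + (0:ℕ)) / p)
  set Γ2 := Gamma (1 + ((n:ℝ) + (2:ℕ)) / p)
  set Γ4 := Gamma (1 + ((n:ℝ) + (4:ℕ)) / p)
  have hV : V = Z / Γ0 := by field_simp; linarith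
  have h2i : I2i = Z * gm p 2 / Γ2 := by field_simp; linarith
  have h2j : I2j = Z * gm p 2 / Γ2 := by field_simp; linarith
  have h4 : I4 ≤ Z * gm p 2 ^ 2 / Γ4 := by
    rw [le_div_iff₀ G4]
    have : Z * ((3 * gm p 2 ^ 2 - gm p 4) * S) ≥ 0 :=
      mul_nonneg hZ.le (mul_nonneg (by linarith) hS)
    linarith
  have hV0 : 0 < V := by rw [hV]; positivity
  calc V⁻¹ * I4 ≤ V⁻¹ * (Z * gm p 2 ^ 2 / Γ4) := by gcongr
    _ = gm p 2 ^ 2 * Γ0 ^ 2 * (1 / (Γ0 * Γ4)) := by rw [hV]; field_simp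
    _ ≤ gm p 2 ^ 2 * Γ0 ^ 2 * (1 / (Γ2 * Γ2)) := by gcongr
    _ = V⁻¹ * I2i * (V⁻¹ * I2j) := by rw [hV, h2i, h2j]; field_simp
end
end
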